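/- Let T ∈ T_n be a type class, u ∈ A^ℓ with 0 ≤ ℓ ≤ n, and define T_u(T) = { x_1⋯x_{n−ℓ} : x^n ∈ T and x_{n−k−ℓ+1}⋯x_{n−k} = u }. If T_u(T) is nonempty, then T_u(T) is itself a full type class of length n−ℓ, i.e., T_u(T) ∈ T_{n−ℓ}. -/

import Mathlib

open Finset

/-- `Finset.filter` with classical decidability. -/
noncomputable def sfilter {α : Type*} (p : α → Prop) (s : Finset α) : Finset α :=
  @Finset.filter α p (Classical.decPred p) s

/-- The finset of all strings of length `n` over the alphabet `A`. -/
def lists (A : Type*) [Fintype A] [DecidableEq A] : ℕ → Finset (List A)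
  | 0 => {[]}
  | n + 1 => Finset.image₂ List.cons Finset.univ (lists A n)

/-- Symbol at (0-indexed) integer position `j` of the string `x`, where negative
positions `-k, …, -1` are given by the fixed initial state `s0`. -/
def symL {A : Type*} [Inhabited A] (k : ℕ) (s0 : Fin k → A) (x : List A) (j : ℤ) : A :=
  if h : 0 ≤ j then
    (if h2 : j.toNat < x.length then x.get ⟨j.toNat, h2⟩ else default)
  else
    (if h3 : (j + k).toNat < k then s0 ⟨(j + k).toNat, h3⟩ else default)

/-- The state (context of order `k`) preceding position `t` of the string `x`. -/
def ctxL {A : Type*} [Inhabited A] (k : ℕ) (s0 : Fin k → A) (x : List A)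
    (t : ℕ) : Fin k → A :=
  fun i => symL k s0 x ((t : ℤ) - (k : ℤ) + (i : ℤ))

/-- `n_{sa}(x)`: number of occurrences of symbol `a` in state `s` within `x`. -/
noncomputable def countL {A : Type*} [Inhabited A] [DecidableEq A] (k : ℕ)
    (s0 : Fin k → A) (s : Fin k → A) (a : A) (x : List A) : ℕ :=
  (sfilter (fun t : Fin x.length => ctxL k s0 x t = s ∧ x.get t = a) Finset.univ).card

/-- Two strings have the same `k`-th order type. -/
def sameTypeL {A : Type*} [Inhabited A] [DecidableEq A] (k : ℕ) (s0 : Fin k → A)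
    (x y : List A) : Prop :=
  x.length = y.length ∧
    ∀ (s : Fin k → A) (a : A), countL k s0 s a x = countL k s0 s a y

/-- The type class `T(x)` as a finset of strings of length `|x|`. -/
noncomputable def typeClassL {A : Type*} [Fintype A] [DecidableEq A] [Inhabited A]
    (k : ℕ) (s0 : Fin k → A) (x : List A) : Finset (List A) :=
  sfilter (fun y => sameTypeL k s0 x y) (lists A x.length)

/-- Probability `P(x) = ∏_t p(x_t | state)` of the string `x`. -/
noncomputable def seqProbL {A : Type*} [Inhabited A] (k : ℕ) (s0 : Fin k → A)
    (p : (Fin k → A) → A → ℝ) (x : List A) : ℝ :=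
  ∏ t : Fin x.length, p (ctxL k s0 x t) (x.get t)

/-- `p` is a (strictly positive) `k`-th order Markov kernel. -/
def IsMarkov {A : Type*} [Fintype A] (k : ℕ) (p : (Fin k → A) → A → ℝ) : Prop :=
  (∀ s a, 0 < p s a) ∧ ∀ s, ∑ a : A, p s a = 1

/-- A prefix-free set of strings. -/
def PrefixFree {A : Type*} (D : Set (List A)) : Prop :=
  ∀ x ∈ D, ∀ y ∈ D, x <+: y → x = y

/-- A complete dictionary: prefix-free, and every string either has a prefix in `D`
or is a prefix of a string in `D`. -/
def CompleteDict {A : Type*} (D : Set (List A)) : Prop :=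
  PrefixFree D ∧ ∀ z : List A, (∃ x ∈ D, x <+: z) ∨ (∃ y ∈ D, z <+: y)

/-- `D ∩ A^n` as a finset. -/
noncomputable def dictAt {A : Type*} [Fintype A] [DecidableEq A]
    (D : Set (List A)) (n : ℕ) : Finset (List A) :=
  sfilter (fun x => x ∈ D) (lists A n)

/-- The failure set at level `n`: strings of length `n` with no prefix in `D`. -/
noncomputable def failAt {A : Type*} [Fintype A] [DecidableEq A]
    (D : Set (List A)) (n : ℕ) : Finset (List A) :=
  sfilter (fun x => ¬ ∃ y ∈ D, y <+: x) (lists A n)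

/-- The failure part of a finite set `T` of strings: members with no prefix in `D`. -/
noncomputable def failIn {A : Type*} (D : Set (List A)) (T : Finset (List A)) :
    Finset (List A) :=
  sfilter (fun x => ¬ ∃ y ∈ D, y <+: x) T

/-- The VFR `(D, ξ, M)` is perfect for the process `p` (at every level `n`,
equivalently at every truncation level): conditioned on `X^n ∈ D ∩ A^n`
(whenever nonempty), `ξ(X^n)` is uniform on `{0, …, M−1}`. -/
def PerfectVFR {A : Type*} [Fintype A] [DecidableEq A] [Inhabited A] (k : ℕ)
    (s0 : Fin k → A) (p : (Fin k → A) → A → ℝ) (D : Set (List A))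
    (ξ : List A → ℕ) (M : ℕ) : Prop :=
  ∀ n : ℕ, (dictAt (A := A) D n).Nonempty →
    ∀ r < M,
      (∑ x ∈ sfilter (fun x => ξ x = r) (dictAt (A := A) D n), seqProbL k s0 p x)
        = (∑ x ∈ dictAt (A := A) D n, seqProbL k s0 p x) / (M : ℝ)

/-- `T_u(T)`: the prefixes of length `n − ℓ` of the members `z` of `T` (strings of
length `n`) whose symbols at positions `n−k−ℓ+1, …, n−k` (1-indexed, with the
initial-state convention for nonpositive indices) form the string `u` (of length `ℓ`). -/
noncomputable def TcutSet {A : Type*} [DecidableEq A] [Inhabited A] (k : ℕ) (s0 : Fin k → A)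
    (T : Finset (List A)) (u : List A) : Finset (List A) :=
  Finset.image (fun z => z.take (z.length - u.length))
    (sfilter (fun z => u.length ≤ z.length ∧
      ∀ i : Fin u.length,
        symL k s0 z ((z.length : ℤ) - (k : ℤ) - (u.length : ℤ) + (i : ℤ)) = u.get i) T)

/-- The state reached from state `g` after emitting the symbol `b`. -/
def stateShift {A : Type*} {k : ℕ} (g : Fin k → A) (b : A) : Fin k → A :=
  fun i => if h : (i : ℕ) + 1 < k then g ⟨i + 1, h⟩ else b

/-- The number of occurrences of `a` in state `s` along `v`, started in state `g`. -/
def countFrom {A : Type*} [DecidableEq A] {k : ℕ} (s : Fin k → A) (a : A) :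
    (Fin k → A) → List A → ℕ
  | _, [] => 0
  | g, b :: v => (if g = s ∧ b = a then 1 else 0) + countFrom s a (stateShift g b) v

theorem mem_sfilter {α : Type*} {p : α → Prop} {s : Finset α} {x : α} :
    x ∈ sfilter p s ↔ x ∈ s ∧ p x := by
  classical
  unfold sfilter
  exact Finset.mem_filter

theorem mem_lists {A : Type*} [Fintype A] [DecidableEq A] {n : ℕ} {x : List A} :
    x ∈ lists A n ↔ x.length = n := by
  induction n generalizing x with
  | zero => simp [lists]
  | succ n ih =>
    cases x with
    | nil => simp [lists]
    | cons b x => simp [lists, ih]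

theorem mem_typeClassL {A : Type*} [Fintype A] [DecidableEq A] [Inhabited A] {k : ℕ}
    {s0 : Fin k → A} {x y : List A} : y ∈ typeClassL k s0 x ↔ sameTypeL k s0 x y := by
  unfold typeClassL
  rw [mem_sfilter, mem_lists]
  exact ⟨fun h => h.2, fun h => ⟨h.1.symm, h⟩⟩

section Context

variable {A : Type*} [Inhabited A] {k : ℕ} {s0 : Fin k → A}

theorem symL_natCast {x : List A} {t : ℕ} (h : t < x.length) : symL k s0 x t = x[t] := by
  simp [symL, h]

theorem symL_append_left (x y : List A) {j : ℤ} (h : j < x.length) :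
    symL k s0 (x ++ y) j = symL k s0 x j := by
  unfold symL
  split_ifs with h0 h1 h2 h2 <;> simp_all <;> omega

theorem ctxL_append_left (x y : List A) {t : ℕ} (h : t ≤ x.length) :
    ctxL k s0 (x ++ y) t = ctxL k s0 x t := by
  funext i
  exact symL_append_left x y (by omega)

theorem ctxL_zero (x : List A) : ctxL k s0 x 0 = s0 := by
  funext i
  have := i.2
  have h : ¬ (0 : ℤ) ≤ ((0 : ℕ) : ℤ) - k + i := by omega
  simp only [ctxL, symL, h, dite_false]
  simp

theorem ctxL_succ {x : List A} {t : ℕ} (h : t < x.length) :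
    ctxL k s0 x (t + 1) = stateShift (ctxL k s0 x t) x[t] := by
  funext i
  have := i.2
  simp only [stateShift, ctxL]
  split_ifs with h1
  · congr 1
    push_cast
    ring
  · rw [← symL_natCast (k := k) (s0 := s0) h]
    congr 1
    omega

theorem ctxL_append_length (x v : List A) :
    ctxL k s0 (x ++ v) (x ++ v).length = v.foldl stateShift (ctxL k s0 x x.length) := by
  induction v generalizing x with
  | nil => simp
  | cons b v ih =>
    have h := ih (x ++ [b])
    rw [List.append_assoc] at h
    simp only [List.singleton_append] at h
    rw [h, List.foldl_cons]
    congr 1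
    have h2 := ctxL_succ (k := k) (s0 := s0) (x := x ++ [b]) (t := x.length) (by simp)
    rw [ctxL_append_left x [b] le_rfl] at h2
    simpa using h2

theorem ctxL_length (x : List A) : ctxL k s0 x x.length = x.foldl stateShift s0 := by
  simpa [ctxL_zero] using ctxL_append_length (k := k) (s0 := s0) [] x

variable [DecidableEq A]

theorem countL_eq_sum (s : Fin k → A) (a : A) (x : List A) :
    countL k s0 s a x =
      ∑ t ∈ range x.length, if ctxL k s0 x t = s ∧ symL k s0 x t = a then 1 else 0 := by
  classical
  unfold countL sfilter
  rw [Finset.card_filter, Finset.sum_range]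
  refine Finset.sum_congr rfl fun t _ => ?_
  rw [symL_natCast t.2]
  simp

theorem countL_concat (s : Fin k → A) (a b : A) (x : List A) :
    countL k s0 s a (x ++ [b]) =
      countL k s0 s a x + if ctxL k s0 x x.length = s ∧ b = a then 1 else 0 := by
  rw [countL_eq_sum, countL_eq_sum, List.length_append, List.length_singleton,
    Finset.sum_range_succ, ctxL_append_left x [b] le_rfl,
    symL_natCast (by simp : x.length < (x ++ [b]).length)]
  congr 1
  · refine Finset.sum_congr rfl fun t ht => ?_
    rw [Finset.mem_range] at ht
    rw [ctxL_append_left x [b] ht.le, symL_append_left x [b] (by omega)]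
  · simp

theorem countL_append (s : Fin k → A) (a : A) (x v : List A) :
    countL k s0 s a (x ++ v) = countL k s0 s a x + countFrom s a (ctxL k s0 x x.length) v := by
  induction v generalizing x with
  | nil => simp [countFrom]
  | cons b v ih =>
    have h := ih (x ++ [b])
    rw [ctxL_append_length, countL_concat, List.append_assoc] at h
    simpa [countFrom, add_assoc] using h

theorem countL_eq_countFrom (s : Fin k → A) (a : A) (x : List A) :
    countL k s0 s a x = countFrom s a s0 x := by
  have h : countL k s0 s a [] = 0 := by simp [countL_eq_sum]
  simpa [ctxL_zero, h] using countL_append (s0 := s0) s a [] x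

end Context

/-- Flow conservation: the visits to a state are balanced, up to the initial and final states. -/
theorem sum_countFrom_add {A : Type*} [Fintype A] [DecidableEq A] {k : ℕ}
    (s g : Fin k → A) (v : List A) :
    (∑ a, countFrom s a g v) + (if v.foldl stateShift g = s then 1 else 0) =
      (if g = s then 1 else 0) +
        ∑ r, ∑ a, if stateShift r a = s then countFrom r a g v else 0 := by
  induction v generalizing g with
  | nil => by_cases h : g = s <;> simp [countFrom, h]
  | cons b v ih =>
    have hout : (∑ a, if g = s ∧ b = a then 1 else 0) = if g = s then 1 else 0 := by
      by_cases h : g = s <;> simp [h]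
    have hin : (∑ r, ∑ a, if stateShift r a = s then (if g = r ∧ b = a then 1 else 0) else 0) =
        if stateShift g b = s then 1 else 0 := by
      rw [Finset.sum_eq_single g, Finset.sum_eq_single b]
      · simp
      · intro a _ ha
        simp [ha.symm]
      · simp
      · intro r _ hr
        simp [hr.symm]
      · simp
    have hsplit : (∑ r, ∑ a, if stateShift r a = s then countFrom r a g (b :: v) else 0) =
        (if stateShift g b = s then 1 else 0) +
          ∑ r, ∑ a, if stateShift r a = s then countFrom r a (stateShift g b) v else 0 := by
      rw [← hin, ← Finset.sum_add_distrib]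
      refine Finset.sum_congr rfl fun r _ => ?_
      rw [← Finset.sum_add_distrib]
      refine Finset.sum_congr rfl fun a _ => ?_
      by_cases h : stateShift r a = s <;> simp [h, countFrom]
    have hrec : (∑ a, countFrom s a (stateShift g b) v) +
        (if (b :: v).foldl stateShift g = s then 1 else 0) =
          (if stateShift g b = s then 1 else 0) +
            ∑ r, ∑ a, if stateShift r a = s then countFrom r a (stateShift g b) v else 0 :=
      ih (stateShift g b)
    rw [hsplit]
    simp only [countFrom, Finset.sum_add_distrib, hout]
    omega

section SameType

variable {A : Type*} [DecidableEq A] [Inhabited A] {k : ℕ} {s0 : Fin k → A}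

theorem sameTypeL.symm {x y : List A} (h : sameTypeL k s0 x y) : sameTypeL k s0 y x :=
  ⟨h.1.symm, fun s a => (h.2 s a).symm⟩

theorem sameTypeL.trans {x y z : List A} (h : sameTypeL k s0 x y) (h' : sameTypeL k s0 y z) :
    sameTypeL k s0 x z :=
  ⟨h.1.trans h'.1, fun s a => (h.2 s a).trans (h'.2 s a)⟩

/-- Sequences of the same type have the same final state. -/
theorem sameTypeL.ctxL_length_eq [Fintype A] {x y : List A} (h : sameTypeL k s0 x y) :
    ctxL k s0 x x.length = ctxL k s0 y y.length := by
  have hc : ∀ s a, countFrom s a s0 x = countFrom s a s0 y := fun s a => by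
    rw [← countL_eq_countFrom, ← countL_eq_countFrom, h.2]
  rw [ctxL_length, ctxL_length]
  have hx := sum_countFrom_add (x.foldl stateShift s0) s0 x
  have hy := sum_countFrom_add (x.foldl stateShift s0) s0 y
  by_contra hne
  rw [if_pos rfl] at hx
  rw [if_neg (Ne.symm hne)] at hy
  simp only [hc] at hx
  omega

/-- Sequences agreeing in type and in the symbols before the final state agree on
the whole window made of these symbols and of the final state. -/
theorem symL_eq_of_window [Fintype A] {x y u : List A} (h : sameTypeL k s0 x y)
    (hx : ∀ i : Fin u.length,
      symL k s0 x ((x.length : ℤ) - (k : ℤ) - (u.length : ℤ) + (i : ℤ)) = u.get i)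
    (hy : ∀ i : Fin u.length,
      symL k s0 y ((y.length : ℤ) - (k : ℤ) - (u.length : ℤ) + (i : ℤ)) = u.get i)
    {j : ℤ} (h1 : (x.length : ℤ) - k - u.length ≤ j) (h2 : j < x.length) :
    symL k s0 x j = symL k s0 y j := by
  have hl := h.1
  by_cases hj : j < (x.length : ℤ) - k
  · obtain ⟨i, hi⟩ : ∃ i : ℕ, j = (x.length : ℤ) - k - u.length + i :=
      ⟨(j - ((x.length : ℤ) - k - u.length)).toNat, by omega⟩
    have hi' : i < u.length := by omega
    have ex := hx ⟨i, hi'⟩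
    have ey := hy ⟨i, hi'⟩
    rw [← hl] at ey
    rw [hi]
    exact ex.trans ey.symm
  · obtain ⟨i, hi⟩ : ∃ i : ℕ, j = (x.length : ℤ) - k + i :=
      ⟨(j - ((x.length : ℤ) - k)).toNat, by omega⟩
    have hi' : i < k := by omega
    have e := congrFun h.ctxL_length_eq ⟨i, hi'⟩
    rw [← hl] at e
    rw [hi]
    exact e

/-- Cutting two sequences that agree on the window yields prefixes of the same type. -/
theorem sameTypeL_left_of_append {y v y' v' : List A} (h : sameTypeL k s0 (y ++ v) (y' ++ v'))
    (hlen : y.length = y'.length)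
    (hw : ∀ j : ℤ, (y.length : ℤ) - k ≤ j → j < (y ++ v).length →
      symL k s0 (y ++ v) j = symL k s0 (y' ++ v') j) :
    sameTypeL k s0 y y' := by
  have hlv : v.length = v'.length := by
    have := h.1
    simp only [List.length_append] at this
    omega
  have hctx : ctxL k s0 y y.length = ctxL k s0 y' y'.length := by
    rw [← ctxL_append_left y v le_rfl, ← ctxL_append_left y' v' le_rfl, ← hlen]
    funext i
    refine hw _ (by omega) ?_
    simp only [List.length_append]
    omega
  have hv : v = v' := by
    refine List.ext_getElem hlv fun i h1 h2 => ?_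
    have := hw (y.length + i : ℕ) (by omega) (by simp only [List.length_append]; omega)
    rw [symL_natCast (by simp only [List.length_append]; omega),
      symL_natCast (by simp only [List.length_append]; omega)] at this
    rw [List.getElem_append_right (by omega), List.getElem_append_right (by omega)] at this
    simpa [hlen] using this
  refine ⟨hlen, fun s a => ?_⟩
  have := h.2 s a
  rw [countL_append, countL_append, hctx, hv] at this
  omega

theorem sameTypeL.append [Fintype A] {y y' : List A} (h : sameTypeL k s0 y y') (v : List A) :
    sameTypeL k s0 (y ++ v) (y' ++ v) :=
  ⟨by simp [h.1], fun s a => by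
    rw [countL_append, countL_append, h.ctxL_length_eq, h.2]⟩

theorem sameTypeL.symL_append [Fintype A] {y y' : List A} (h : sameTypeL k s0 y y') (v : List A)
    {j : ℤ} (h1 : (y.length : ℤ) - k ≤ j) (h2 : j < (y ++ v).length) :
    symL k s0 (y ++ v) j = symL k s0 (y' ++ v) j := by
  have hl := h.1
  rw [List.length_append] at h2
  by_cases hj : j < y.length
  · rw [symL_append_left y v hj, symL_append_left y' v (by omega)]
    have e := congrFun h.ctxL_length_eq ⟨(j - ((y.length : ℤ) - k)).toNat, by omega⟩
    simp only [ctxL, ← hl] at e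
    convert e using 2 <;> omega
  · obtain ⟨t, rfl⟩ := Int.eq_ofNat_of_zero_le (by omega : 0 ≤ j)
    rw [symL_natCast (by simp only [List.length_append]; omega),
      symL_natCast (by simp only [List.length_append]; omega),
      List.getElem_append_right (by omega), List.getElem_append_right (by omega)]
    simp [hl]

end SameType

theorem mem_TcutSet {A : Type*} [Fintype A] [DecidableEq A] [Inhabited A] {k : ℕ}
    {s0 : Fin k → A} {x u w : List A} :
    w ∈ TcutSet k s0 (typeClassL k s0 x) u ↔
      ∃ v : List A, v.length = u.length ∧ sameTypeL k s0 x (w ++ v) ∧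
        ∀ i : Fin u.length,
          symL k s0 (w ++ v) (((w ++ v).length : ℤ) - (k : ℤ) - (u.length : ℤ) + (i : ℤ))
            = u.get i := by
  unfold TcutSet
  simp only [Finset.mem_image, mem_sfilter, mem_typeClassL]
  constructor
  · rintro ⟨z, ⟨hz, hlen, hwin⟩, rfl⟩
    refine ⟨z.drop (z.length - u.length), by rw [List.length_drop]; omega, ?_⟩
    rw [List.take_append_drop]
    exact ⟨hz, hwin⟩
  · rintro ⟨v, hv, hz, hwin⟩
    refine ⟨w ++ v, ⟨hz, by simp [hv], hwin⟩, ?_⟩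
    simp [hv]

/-- If nonempty, `T_u(T)` is itself a full type class of length
`n − ℓ`, i.e. it equals `T(w)` for some string `w` of length `n − ℓ`. -/
theorem Tcut_is_type_class {A : Type*} [Fintype A] [DecidableEq A] [Inhabited A]
    (hA : 2 ≤ Fintype.card A) (k : ℕ) (s0 : Fin k → A)
    (x u : List A) (hu : u.length ≤ x.length)
    (hne : (TcutSet k s0 (typeClassL k s0 x) u).Nonempty) :
    ∃ w : List A, w.length = x.length - u.length ∧
      TcutSet k s0 (typeClassL k s0 x) u = typeClassL k s0 w := by
  obtain ⟨w, hw⟩ := hne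
  obtain ⟨v, hv, hz, hwin⟩ := mem_TcutSet.1 hw
  have hlen : (w ++ v).length = w.length + v.length := List.length_append
  refine ⟨w, by have := hz.1; omega, ?_⟩
  ext y
  rw [mem_TcutSet, mem_typeClassL]
  constructor
  · rintro ⟨v', hv', hz', hwin'⟩
    have hlen' : (y ++ v').length = y.length + v'.length := List.length_append
    have h := hz.symm.trans hz'
    have := h.1
    refine sameTypeL_left_of_append h (by omega) fun j h1 h2 => ?_
    exact symL_eq_of_window h hwin hwin' (by omega) h2
  · intro h
    have ha := h.append v
    refine ⟨v, hv, hz.trans ha, fun i => ?_⟩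
    rw [← hwin i, ← ha.1]
    exact (h.symL_append v (by omega) (by omega)).symm
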